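/- arXiv:1812.03964 — 2 statements merged into one kernel-verified Lean document; each statement's English description precedes it below -/
import Mathlib

section
/- Let n ≥ 0 and let f_0, …, f_{n+1} ∈ ℂ[x_0, …, x_{n+1}] be homogeneous polynomials with deg f_i = d_i ≥ 1 whose only common zero in ℂ^{n+2} is the origin. Set R := ℂ[x_0, …, x_{n+1}]/⟨f_0, …, f_{n+1}⟩ and σ := Σ_{i=0}^{n+1} (d_i − 1). Then: (i) dim_ℂ R_σ = 1; (ii) for every 0 ≤ i ≤ σ the ℂ-bilinear map R_i × R_{σ−i} → R_σ induced by multiplication is a perfect pairing (for every nonzero a ∈ R_i there is b ∈ R_{σ−i} with ab ≠ 0, and for every nonzero b ∈ R_{σ−i} there is a ∈ R_i with ab ≠ 0); (iii) R_e = 0 for every e > σ. (Macaulay's theorem.) -/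
open MvPolynomial

/-- The degree-`e` graded piece of the quotient `ℂ[x_0,…,x_{N-1}]/I`: the image in the
quotient of the space of homogeneous polynomials of degree `e`. -/
noncomputable def gradedPiece {N : ℕ} (I : Ideal (MvPolynomial (Fin N) ℂ)) (e : ℕ) :
    Submodule ℂ (MvPolynomial (Fin N) ℂ ⧸ I) :=
  (MvPolynomial.homogeneousSubmodule (Fin N) ℂ e).map (Ideal.Quotient.mkₐ ℂ I).toLinearMap

section Koszul

variable {R : Type*} [CommRing R] {ι : Type*} [Fintype ι] {M : Type*} [AddCommGroup M] [Module R M]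

/-- The Koszul differential on alternating forms: contraction with the vector `v`. -/
def koszulDiff (M : Type*) [AddCommGroup M] [Module R M] (v : ι → R) (n : ℕ) :
    ((ι → R) [⋀^Fin (n + 1)]→ₗ[R] M) →ₗ[R] ((ι → R) [⋀^Fin n]→ₗ[R] M) :=
  AlternatingMap.curryLeftLinearMap.flip v

omit [Fintype ι] in
lemma koszulDiff_apply (v : ι → R) (n : ℕ) (c : (ι → R) [⋀^Fin (n + 1)]→ₗ[R] M)
    (w : Fin n → ι → R) : koszulDiff M v n c w = c (Matrix.vecCons v w) := rfl

omit [Fintype ι] in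
lemma koszulDiff_koszulDiff (v : ι → R) (n : ℕ) (c : (ι → R) [⋀^Fin (n + 2)]→ₗ[R] M) :
    koszulDiff M v n (koszulDiff M v (n + 1) c) = 0 :=
  c.curryLeft_same v

/-- The exterior product of a linear form with an alternating form. -/
def linearWedge {n : ℕ} (e : (ι → R) →ₗ[R] R) (c : (ι → R) [⋀^Fin n]→ₗ[R] M) :
    (ι → R) [⋀^Fin (n + 1)]→ₗ[R] M :=
  AlternatingMap.alternatizeUncurryFin (e.smulRight c)

omit [Fintype ι] in
lemma koszulDiff_linearWedge_zero (v : ι → R) (e : (ι → R) →ₗ[R] R)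
    (c : (ι → R) [⋀^Fin 0]→ₗ[R] M) : koszulDiff M v 0 (linearWedge e c) = e v • c := by
  ext w
  rw [koszulDiff_apply, linearWedge, AlternatingMap.alternatizeUncurryFin_apply]
  simp [Subsingleton.elim _ w]

omit [Fintype ι] in
lemma koszulDiff_linearWedge {n : ℕ} (v : ι → R) (e : (ι → R) →ₗ[R] R)
    (c : (ι → R) [⋀^Fin (n + 1)]→ₗ[R] M) (hc : koszulDiff M v n c = 0) :
    koszulDiff M v (n + 1) (linearWedge e c) = e v • c := by
  ext w
  rw [koszulDiff_apply, linearWedge, AlternatingMap.alternatizeUncurryFin_apply, Fin.sum_univ_succ,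
    Finset.sum_eq_zero, add_zero]
  · simp
  · intro i _
    have : c (i.succ.removeNth (Matrix.vecCons v w)) = 0 := by
      have h := congrArg (fun a => a (i.removeNth w)) hc
      simp only [koszulDiff_apply, AlternatingMap.zero_apply] at h
      rw [← h]
      congr 1
      ext j : 1
      refine Fin.cases ?_ (fun j => ?_) j <;> simp [Fin.removeNth]
    simp [this]

lemma AlternatingMap.eq_zero_of_card_lt {n : ℕ} (hn : Fintype.card ι < n)
    (c : (ι → R) [⋀^Fin n]→ₗ[R] M) : c = 0 := by
  classical
  refine (Pi.basisFun R ι).ext_alternating fun w hw => ?_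
  have := Fintype.card_le_of_injective w hw
  simp at this
  omega

/-- Alternating forms lift along surjections of coefficient modules. -/
lemma AlternatingMap.exists_compAlternatingMap_eq {n : ℕ} {M' : Type*} [AddCommGroup M'] [Module R M']
    (g : M →ₗ[R] M') (hg : Function.Surjective g) (c : (ι → R) [⋀^Fin n]→ₗ[R] M') :
    ∃ c' : (ι → R) [⋀^Fin n]→ₗ[R] M, g.compAlternatingMap c' = c := by
  obtain ⟨h, hh⟩ := Module.projective_lifting_property g
    (exteriorPower.alternatingMapLinearEquiv c) hg
  refine ⟨exteriorPower.alternatingMapLinearEquiv.symm h, ?_⟩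
  ext w
  have := congrArg (fun a => a (exteriorPower.ιMulti R n w)) hh
  simpa using this

instance AlternatingMap.projective_pi {n : ℕ} : Module.Projective R ((ι → R) [⋀^Fin n]→ₗ[R] R) :=
  Module.Projective.of_equiv (exteriorPower.alternatingMapLinearEquiv
    (R := R) (M := ι → R) (N := R) (n := n)).symm

omit [Fintype ι] in
/-- An alternating form whose values are multiples of a regular element is a multiple of it. -/
lemma AlternatingMap.exists_smul_eq {n : ℕ} {r : R} (hr : IsSMulRegular M r)
    (c : (ι → R) [⋀^Fin n]→ₗ[R] M) (hc : ∀ w, ∃ m, r • m = c w) :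
    ∃ c' : (ι → R) [⋀^Fin n]→ₗ[R] M, r • c' = c := by
  have hinj : Function.Injective (LinearMap.lsmul R M r) := hr
  let E := LinearEquiv.ofInjective (LinearMap.lsmul R M r) hinj
  refine ⟨E.symm.toLinearMap.compAlternatingMap (c.codRestrict _ fun w => ?_), ?_⟩
  · obtain ⟨m, hm⟩ := hc w
    exact ⟨m, hm⟩
  · ext w
    have : ∀ z, r • E.symm z = z := fun z => congrArg Subtype.val (E.apply_symm_apply z)
    simp [this]

open scoped Pointwise in
/-- Depth sensitivity of the Koszul complex. -/
theorem exists_koszulDiff_eq (v : ι → R) (rs : List R) (hrs : ∀ r ∈ rs, ∃ i, v i = r) :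
    ∀ (M : Type*) [AddCommGroup M] [Module R M], RingTheory.Sequence.IsWeaklyRegular M rs →
    ∀ (n : ℕ), Fintype.card ι < n + 1 + rs.length →
    ∀ c : (ι → R) [⋀^Fin (n + 1)]→ₗ[R] M, koszulDiff M v n c = 0 →
    ∃ b, koszulDiff M v (n + 1) b = c := by
  induction rs with
  | nil =>
    intro M _ _ _ n hn c _
    exact ⟨0, by rw [AlternatingMap.eq_zero_of_card_lt (by simpa using hn) c, map_zero]⟩
  | cons r rs ih =>
    intro M _ _ hreg n hn c hc
    rw [RingTheory.Sequence.isWeaklyRegular_cons_iff] at hreg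
    obtain ⟨i, hi⟩ := hrs r (by simp)
    set b := linearWedge (LinearMap.proj i) c with hb
    have hb' : koszulDiff M v (n + 1) b = r • c := by
      rw [hb, koszulDiff_linearWedge _ _ _ hc]; simp [hi]
    let q : M →ₗ[R] QuotSMulTop r M := Submodule.mkQ _
    have hq : Function.Surjective q := Submodule.mkQ_surjective _
    have hker : ∀ m, q m = 0 → ∃ m', r • m' = m := by
      intro m hm
      have : m ∈ r • (⊤ : Submodule R M) := (Submodule.Quotient.mk_eq_zero _).1 hm
      simpa [Submodule.mem_smul_pointwise_iff_exists] using this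
    have hq0 : ∀ m, q (r • m) = 0 := fun m =>
      (Submodule.Quotient.mk_eq_zero _).2 (Submodule.smul_mem_pointwise_smul _ _ _ trivial)
    obtain ⟨wbar, hw⟩ := ih (fun r hr => hrs r (by simp [hr])) _ hreg.2 (n + 1)
      (by simp at hn; omega) (q.compAlternatingMap b) (by
        ext x
        have := congrArg (fun a => q (a x)) hb'
        simpa [koszulDiff_apply, hq0] using this)
    obtain ⟨w, rfl⟩ := AlternatingMap.exists_compAlternatingMap_eq q hq wbar
    obtain ⟨c', hc'⟩ := AlternatingMap.exists_smul_eq hreg.1 (b - koszulDiff M v _ w) (by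
      intro x
      apply hker
      have := congrArg (fun a => a x) hw
      simp only [koszulDiff_apply, LinearMap.compAlternatingMap_apply] at this
      simp [koszulDiff_apply, this])
    refine ⟨c', ?_⟩
    ext x
    apply hreg.1
    have h1 := congrArg (koszulDiff M v (n + 1)) hc'
    rw [map_sub, koszulDiff_koszulDiff, sub_zero, hb', map_smul] at h1
    exact congrArg (fun a => a x) h1

end Koszul

section ChainLift

variable {R : Type*} [CommRing R]

lemma Module.Projective.exists_comp_eq {P A B : Type*} [AddCommGroup P] [AddCommGroup A]
    [AddCommGroup B] [Module R P] [Module R A] [Module R B] [Module.Projective R P]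
    (g : A →ₗ[R] B) (f : P →ₗ[R] B) (h : ∀ x, ∃ y, g y = f x) : ∃ k : P →ₗ[R] A, g ∘ₗ k = f := by
  obtain ⟨k, hk⟩ := Module.projective_lifting_property g.rangeRestrict
    (f.codRestrict (LinearMap.range g) h) g.surjective_rangeRestrict
  refine ⟨k, ?_⟩
  ext x
  exact congrArg (fun a => (a x : B)) hk

variable {P Q : ℕ → Type*} [∀ n, AddCommGroup (P n)] [∀ n, Module R (P n)]
  [∀ n, AddCommGroup (Q n)] [∀ n, Module R (Q n)]

/-- Lifting a map from a complex of projectives to an acyclic complex. -/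
lemma exists_chainMap_lift [∀ n, Module.Projective R (P n)]
    (dP : ∀ n, P (n + 1) →ₗ[R] P n) (dQ : ∀ n, Q (n + 1) →ₗ[R] Q n)
    (hP : ∀ n x, dP n (dP (n + 1) x) = 0) (hQ : ∀ n x, dQ n x = 0 → ∃ y, dQ (n + 1) y = x)
    (φ₀ : P 0 →ₗ[R] Q 0) (h₀ : ∀ x, ∃ y, dQ 0 y = φ₀ (dP 0 x)) :
    ∃ φ : ∀ n, P n →ₗ[R] Q n, φ 0 = φ₀ ∧ ∀ n x, dQ n (φ (n + 1) x) = φ n (dP n x) := by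
  let T := fun n => {p : P n →ₗ[R] Q n // ∀ x, ∃ y, dQ n y = p (dP n x)}
  have step : ∀ n (p : T n), ∃ p' : T (n + 1), ∀ x, dQ n (p'.1 x) = p.1 (dP n x) := by
    rintro n ⟨p, hp⟩
    obtain ⟨p', hp'⟩ := Module.Projective.exists_comp_eq (dQ n) (p ∘ₗ dP n) hp
    have hp'' : ∀ x, dQ n (p' x) = p (dP n x) := fun x => congrArg (fun a => a x) hp'
    exact ⟨⟨p', fun x => hQ n _ (by rw [hp'', hP, map_zero])⟩, hp''⟩
  choose F hF using step
  let φ : ∀ n, T n := fun n => Nat.rec ⟨φ₀, h₀⟩ F n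
  exact ⟨fun n => (φ n).1, rfl, fun n => hF n (φ n)⟩

/-- A chain endomorphism of an acyclic complex of projectives which vanishes in degree zero is
nullhomotopic. -/
lemma exists_nullhomotopy [∀ n, Module.Projective R (Q n)] (dQ : ∀ n, Q (n + 1) →ₗ[R] Q n)
    (hd : ∀ n x, dQ n (dQ (n + 1) x) = 0) (hQ : ∀ n x, dQ n x = 0 → ∃ y, dQ (n + 1) y = x)
    (θ : ∀ n, Q n →ₗ[R] Q n) (hθ : ∀ n x, dQ n (θ (n + 1) x) = θ n (dQ n x)) (hθ₀ : θ 0 = 0) :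
    ∃ s : ∀ n, Q n →ₗ[R] Q (n + 1),
      ∀ n x, θ (n + 1) x = dQ (n + 1) (s (n + 1) x) + s n (dQ n x) := by
  let T := fun n => {s : Q n →ₗ[R] Q (n + 1) // ∀ x, dQ n (s (dQ n x)) = θ n (dQ n x)}
  have step : ∀ n (s : T n), ∃ s' : T (n + 1),
      ∀ x, θ (n + 1) x = dQ (n + 1) (s'.1 x) + s.1 (dQ n x) := by
    rintro n ⟨s, hs⟩
    obtain ⟨s', hs'⟩ := Module.Projective.exists_comp_eq (dQ (n + 1)) (θ (n + 1) - s ∘ₗ dQ n)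
      (fun x => hQ n _ (by simp [hθ, hs]))
    have hs'' : ∀ x, dQ (n + 1) (s' x) = θ (n + 1) x - s (dQ n x) :=
      fun x => congrArg (fun a => a x) hs'
    exact ⟨⟨s', fun x => by rw [hs'', hd, map_zero, sub_zero]⟩, fun x => by simp [hs'']⟩
  choose F hF using step
  let s : ∀ n, T n := fun n => Nat.rec ⟨0, fun x => by simp [hθ₀]⟩ F n
  exact ⟨fun n => (s n).1, fun n => hF n (s n)⟩

end ChainLift

section Wiebe

variable {R : Type*} [CommRing R] {m : ℕ}

lemma koszulDiff_eq_sum {ι : Type*} [Fintype ι] [DecidableEq ι] (v : ι → R) (n : ℕ)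
    (c : (ι → R) [⋀^Fin (n + 1)]→ₗ[R] R) :
    koszulDiff R v n c = ∑ i, v i • koszulDiff R (Pi.single i (1 : R)) n c := by
  have : v = ∑ i, v i • (Pi.single i 1 : ι → R) := pi_eq_sum_univ' v
  conv_lhs => rw [this]
  simp [koszulDiff]

lemma koszulDiff_compLinearMap {ι : Type*} (g : (ι → R) →ₗ[R] (ι → R)) (v : ι → R) (n : ℕ)
    (c : (ι → R) [⋀^Fin (n + 1)]→ₗ[R] R) :
    koszulDiff R v n (c.compLinearMap g) = (koszulDiff R (g v) n c).compLinearMap g :=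
  c.curryLeft_compLinearMap g v

/-- If `y = A f` and the Koszul complex of `y` is acyclic, then the annihilator of `f` modulo `y`
is generated by `det A`. -/
theorem exists_sub_mul_det_mem_span (y f : Fin (m + 1) → R) (A : Matrix (Fin (m + 1)) (Fin (m + 1)) R)
    (hA : A.mulVec f = y)
    (hy : ∀ n (c : (Fin (m + 1) → R) [⋀^Fin (n + 1)]→ₗ[R] R), koszulDiff R y n c = 0 →
      ∃ b, koszulDiff R y (n + 1) b = c)
    (h : R) (hh : ∀ j, h * f j ∈ Ideal.span (Set.range y)) :
    ∃ e, h - e * A.det ∈ Ideal.span (Set.range y) := by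
  obtain ⟨ψ, hψ₀, hψ⟩ := exists_chainMap_lift
    (P := fun n => (Fin (m + 1) → R) [⋀^Fin n]→ₗ[R] R)
    (Q := fun n => (Fin (m + 1) → R) [⋀^Fin n]→ₗ[R] R) (koszulDiff R f) (koszulDiff R y)
    (koszulDiff_koszulDiff f) hy (h • LinearMap.id) (by
      intro c
      change _ ∈ LinearMap.range (koszulDiff R y 0)
      rw [koszulDiff_eq_sum]
      simp only [LinearMap.smul_apply, LinearMap.id_apply, Finset.smul_sum, smul_smul]
      refine Submodule.sum_mem _ fun j _ => ?_
      obtain ⟨b, hb⟩ := Ideal.mem_span_range_iff_exists_fun.1 (hh j)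
      refine ⟨linearWedge (∑ i, b i • LinearMap.proj i)
        (koszulDiff R (Pi.single j (1 : R)) 0 c), ?_⟩
      rw [koszulDiff_linearWedge_zero, ← hb]
      simp)
  let φ : ∀ n, ((Fin (m + 1) → R) [⋀^Fin n]→ₗ[R] R) →ₗ[R] ((Fin (m + 1) → R) [⋀^Fin n]→ₗ[R] R) :=
    fun n =>
      { toFun := fun c => c.compLinearMap A.mulVecLin
        map_add' := fun _ _ => rfl
        map_smul' := fun _ _ => rfl }
  obtain ⟨s, hs⟩ := exists_nullhomotopy
    (Q := fun n => (Fin (m + 1) → R) [⋀^Fin n]→ₗ[R] R) (koszulDiff R y) (koszulDiff_koszulDiff y) hy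
    (fun n => ψ n ∘ₗ φ n - h • LinearMap.id) (by
      intro n c
      have h1 : koszulDiff R f n (φ (n + 1) c) = φ n (koszulDiff R y n c) := by
        have := koszulDiff_compLinearMap A.mulVecLin f n c
        rw [Matrix.mulVecLin_apply, hA] at this
        exact this
      simp [hψ, h1]) (by
      ext c w
      have : φ 0 c = c := by
        ext w
        change c _ = c _
        congr 1
        exact Subsingleton.elim _ _
      simp [hψ₀, this])
  obtain ⟨D, hD⟩ : ∃ D : (Fin (m + 1) → R) [⋀^Fin (m + 1)]→ₗ[R] R,
      ∀ w, D w = (Matrix.of w).det := ⟨Matrix.detRowAlternating, fun _ => rfl⟩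
  let I : Fin (m + 1) → Fin (m + 1) → R := fun i => Pi.single i 1
  have hI : D I = 1 := by
    rw [hD, ← Matrix.det_one (n := Fin (m + 1)) (R := R)]
    congr 1
    ext i j
    simp [I, Matrix.one_apply, Pi.single_apply, eq_comm]
  have hφ : φ (m + 1) D = A.det • D := by
    ext w
    change D (fun i => A.mulVec (w i)) = A.det * D w
    rw [hD, hD, ← Matrix.det_transpose A, mul_comm, ← Matrix.det_mul]
    congr 1
    ext i j
    simp [Matrix.mulVec, dotProduct, Matrix.mul_apply, mul_comm]
  have htop := hs m D
  rw [AlternatingMap.eq_zero_of_card_lt (by simp) (s (m + 1) _), map_zero, zero_add] at htop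
  have heval := congrArg (fun a => a I) htop
  refine ⟨ψ (m + 1) D I, ?_⟩
  rw [← neg_mem_iff]
  simp only [LinearMap.sub_apply, LinearMap.comp_apply, hφ, map_smul, LinearMap.smul_apply,
    LinearMap.id_apply, AlternatingMap.sub_apply, AlternatingMap.smul_apply, hI, smul_eq_mul,
    mul_one] at heval
  rw [neg_sub, mul_comm, heval, koszulDiff_eq_sum]
  let ev : ((Fin (m + 1) → R) [⋀^Fin (m + 1)]→ₗ[R] R) →ₗ[R] R :=
    { toFun := fun c => c I
      map_add' := fun _ _ => rfl
      map_smul' := fun _ _ => rfl }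
  change ev (s m _) ∈ _
  rw [map_sum, map_sum]
  refine Ideal.sum_mem _ fun i _ => ?_
  rw [map_smul, map_smul, smul_eq_mul]
  exact Ideal.mul_mem_right _ _ (Ideal.subset_span ⟨i, rfl⟩)

end Wiebe

section Monomial

namespace MvPolynomial

lemma mem_span_X_pow_image {σ R : Type*} [CommSemiring R] {k : ℕ} {s : Set σ}
    {p : MvPolynomial σ R} :
    p ∈ Ideal.span ((fun i => (X i : MvPolynomial σ R) ^ k) '' s) ↔
      ∀ u ∈ p.support, ∃ i ∈ s, k ≤ u i := by
  have := @mem_ideal_span_monomial_image σ R _ p ((fun i => Finsupp.single i k) '' s)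
  rw [Set.image_image] at this
  simp only [← X_pow_eq_monomial] at this
  refine this.trans ?_
  simp

lemma mem_span_X_pow_range {σ R : Type*} [CommSemiring R] {k : ℕ} {p : MvPolynomial σ R} :
    p ∈ Ideal.span (Set.range fun i => (X i : MvPolynomial σ R) ^ k) ↔
      ∀ u ∈ p.support, ∃ i, k ≤ u i := by
  rw [← Set.image_univ, mem_span_X_pow_image]
  simp

lemma isWeaklyRegular_X_pow (R : Type*) [CommRing R] (N k : ℕ) :
    RingTheory.Sequence.IsWeaklyRegular (MvPolynomial (Fin N) R)
      (List.ofFn fun i : Fin N => (X i : MvPolynomial (Fin N) R) ^ k) := by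
  refine ⟨fun i hi => ?_⟩
  have hi' : i < N := by simpa using hi
  have hI : (Ideal.ofList ((List.ofFn fun i : Fin N => (X i : MvPolynomial (Fin N) R) ^ k).take i) •
      (⊤ : Submodule (MvPolynomial (Fin N) R) (MvPolynomial (Fin N) R))) =
      Ideal.span ((fun i => (X i : MvPolynomial (Fin N) R) ^ k) '' {j | j.1 < i}) := by
    rw [smul_eq_mul, Ideal.mul_top]
    refine congrArg Ideal.span (Set.ext fun p => ?_)
    simp only [Set.mem_ofPred_eq, List.mem_take_iff_getElem, List.getElem_ofFn, Set.mem_image,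
      List.length_ofFn]
    constructor
    · rintro ⟨j, hj, rfl⟩
      exact ⟨⟨j, by omega⟩, by simp; omega, rfl⟩
    · rintro ⟨j, hj, rfl⟩
      exact ⟨j, by omega, rfl⟩
  rw [hI, isSMulRegular_quotient_iff_mem_of_smul_mem]
  intro p hp
  rw [mem_span_X_pow_image] at hp ⊢
  intro u hu
  obtain ⟨j, hj, hk⟩ := hp (u + Finsupp.single ⟨i, hi'⟩ k) (by
    rw [mem_support_iff] at hu ⊢
    rw [smul_eq_mul, mul_comm, List.getElem_ofFn, X_pow_eq_monomial, coeff_mul_monomial]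
    simpa using hu)
  refine ⟨j, hj, ?_⟩
  rwa [Finsupp.add_apply, Finsupp.single_eq_of_ne, add_zero] at hk
  rintro rfl
  simp at hj

variable {σ : Type*} [Finite σ]

/-- The exponent of the socle generator modulo the `(K + 1)`-st powers of the variables. -/
noncomputable def socleExponent (σ : Type*) [Finite σ] (K : ℕ) : σ →₀ ℕ :=
  Finsupp.equivFunOnFinite.symm fun _ => K

@[simp]
lemma socleExponent_apply (K : ℕ) (i : σ) : socleExponent σ K i = K := rfl

variable {R : Type*} [CommSemiring R] {K : ℕ}

lemma exists_coeff_socleExponent_ne_zero {p : MvPolynomial σ R}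
    (hp : p ∉ Ideal.span (Set.range fun i => (X i : MvPolynomial σ R) ^ (K + 1))) :
    ∃ u, coeff (socleExponent σ K) (p * monomial u 1) ≠ 0 := by
  rw [mem_span_X_pow_range] at hp
  push Not at hp
  obtain ⟨v, hv, hvK⟩ := hp
  have hle : v ≤ socleExponent σ K := fun i => Nat.lt_succ_iff.1 (hvK i)
  refine ⟨socleExponent σ K - v, ?_⟩
  rw [← add_tsub_cancel_of_le hle, add_tsub_cancel_left, coeff_mul_monomial, mul_one]
  exact mem_support_iff.1 hv

lemma coeff_socleExponent_eq_zero {p : MvPolynomial σ R}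
    (hp : p ∈ Ideal.span (Set.range fun i => (X i : MvPolynomial σ R) ^ (K + 1))) :
    coeff (socleExponent σ K) p = 0 := by
  by_contra h
  obtain ⟨i, hi⟩ := mem_span_X_pow_range.1 hp _ (mem_support_iff.2 h)
  simp at hi

/-- Double annihilators modulo powers of the variables are trivial. -/
lemma mem_of_forall_mul_mem {F : Type*} [Field F] {I : Ideal (MvPolynomial σ F)}
    (hJ : Ideal.span (Set.range fun i => (X i : MvPolynomial σ F) ^ (K + 1)) ≤ I)
    (g : MvPolynomial σ F)
    (hg : ∀ h, (∀ a ∈ I, h * a ∈ Ideal.span (Set.range fun i => (X i : MvPolynomial σ F) ^ (K + 1))) →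
      h * g ∈ Ideal.span (Set.range fun i => (X i : MvPolynomial σ F) ^ (K + 1))) : g ∈ I := by
  classical
  by_contra hgI
  obtain ⟨l, hlg, hlI⟩ := Submodule.exists_le_ker_of_notMem
    (p := I.restrictScalars F) (v := g) hgI
  have := Fintype.ofFinite σ
  set t := socleExponent σ K with ht
  let h : MvPolynomial σ F := ∑ v ∈ Finset.Iic t, monomial (t - v) (l (monomial v 1))
  have key : ∀ p, coeff t (h * p) = l p := by
    have : lcoeff F t ∘ₗ LinearMap.mulLeft F h = l := by
      ext w
      change coeff t (h * monomial w 1) = l (monomial w 1)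
      rw [coeff_mul_monomial']
      split_ifs with hw
      · simp only [h, coeff_sum, coeff_monomial, mul_one]
        rw [Finset.sum_eq_single w]
        · simp
        · intro v hv hvw
          rw [if_neg]
          intro heq
          refine hvw (Finsupp.ext fun i => ?_)
          have h1 := DFunLike.congr_fun heq i
          have h2 := Finset.mem_Iic.1 hv i
          have h3 := hw i
          simp only [Finsupp.tsub_apply] at h1
          omega
        · simp [hw]
      · symm
        apply hlI
        apply hJ
        rw [mem_span_X_pow_range]
        intro u hu
        obtain rfl : u = w := by simpa using support_monomial_subset hu
        by_contra! hcon
        exact hw fun i => Nat.lt_succ_iff.1 (hcon i)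
    exact fun p => congrArg (fun a => a p) this
  refine hlg ?_
  rw [← key]
  refine coeff_socleExponent_eq_zero (hg h fun a ha => ?_)
  by_contra hcon
  obtain ⟨u, hu⟩ := exists_coeff_socleExponent_ne_zero hcon
  rw [mul_assoc, key] at hu
  exact hu (hlI (I.mul_mem_right _ ha))

end MvPolynomial

end Monomial

section Macaulay

namespace MvPolynomial

lemma homogeneousComponent_mul_of_isHomogeneous {σ R : Type*} [CommSemiring R] {n i : ℕ}
    (a : MvPolynomial σ R) {b : MvPolynomial σ R} (hb : b.IsHomogeneous i) (h : i ≤ n) :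
    homogeneousComponent n (a * b) = homogeneousComponent (n - i) a * b := by
  let _ := gradedAlgebra (σ := σ) (R := R)
  have := DirectSum.coe_decompose_mul_of_right_mem_of_le (homogeneousSubmodule σ R) (a := a)
    (n := n) hb h
  rw [← decomposition.decompose'_apply, ← decomposition.decompose'_apply]
  exact this

lemma IsHomogeneous.degree_eq {σ R : Type*} [CommSemiring R] {n : ℕ} {p : MvPolynomial σ R}
    (hp : p.IsHomogeneous n) {u : σ →₀ ℕ} (hu : coeff u p ≠ 0) : u.degree = n := by
  by_contra h
  exact hu (hp.coeff_eq_zero h)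

lemma degree_socleExponent (σ : Type*) [Fintype σ] (K : ℕ) :
    (socleExponent σ K).degree = Fintype.card σ * K := by
  simp [Finsupp.degree_eq_sum]

variable {F : Type*} [Field F]

/-- A homogeneous element of a homogeneously generated ideal is a combination of the generators with
homogeneous coefficients. -/
lemma exists_homogeneous_coeffs {σ ι : Type*} [Fintype ι] {d : ι → ℕ} {f : ι → MvPolynomial σ F}
    (hf : ∀ j, (f j).IsHomogeneous (d j)) {n : ℕ} (hn : ∀ j, d j ≤ n) {p : MvPolynomial σ F}
    (hp : p.IsHomogeneous n) (hpI : p ∈ Ideal.span (Set.range f)) :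
    ∃ a : ι → MvPolynomial σ F, (∀ j, (a j).IsHomogeneous (n - d j)) ∧ ∑ j, a j * f j = p := by
  obtain ⟨c, hc⟩ := Ideal.mem_span_range_iff_exists_fun.1 hpI
  refine ⟨fun j => homogeneousComponent (n - d j) (c j),
    fun j => homogeneousComponent_isHomogeneous _ _, ?_⟩
  have h := homogeneousComponent_of_mem (m := n) hp
  rw [if_pos rfl] at h
  refine Eq.trans ?_ h
  rw [← hc, map_sum]
  exact Finset.sum_congr rfl fun j _ =>
    (homogeneousComponent_mul_of_isHomogeneous _ (hf j) (hn j)).symm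

variable {m : ℕ} {d : Fin (m + 1) → ℕ} {f : Fin (m + 1) → MvPolynomial (Fin (m + 1)) F}

lemma exists_X_pow_mem [IsAlgClosed F]
    (hzero : ∀ x : Fin (m + 1) → F, (∀ i, eval x (f i) = 0) → x = 0) :
    ∃ K₀ : ℕ, ∀ K, K₀ ≤ K → ∀ i, (X i : MvPolynomial (Fin (m + 1)) F) ^ K ∈
      Ideal.span (Set.range f) := by
  have hrad : ∀ i, X i ∈ (Ideal.span (Set.range f)).radical := by
    intro i
    rw [← vanishingIdeal_zeroLocus_eq_radical (K := F), mem_vanishingIdeal_iff]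
    intro x hx
    have : x = 0 := hzero x fun j => by
      simpa [aeval_eq_eval] using hx (f j) (Ideal.subset_span ⟨j, rfl⟩)
    simp [this]
  choose k hk using hrad
  refine ⟨∑ i, k i, fun K hK i => Ideal.pow_mem_of_pow_mem _ (hk i) (le_trans ?_ hK)⟩
  exact Finset.single_le_sum (fun _ _ => Nat.zero_le _) (Finset.mem_univ i)

/-- The ideal `(f)` is linked by a homogeneous determinant to an ideal of powers of variables. -/
theorem exists_linkage [IsAlgClosed F] (hd : ∀ i, 1 ≤ d i) (hhom : ∀ i, (f i).IsHomogeneous (d i))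
    (hzero : ∀ x : Fin (m + 1) → F, (∀ i, eval x (f i) = 0) → x = 0) :
    ∃ (K δ : ℕ) (D : MvPolynomial (Fin (m + 1)) F), D.IsHomogeneous δ ∧
      δ + ∑ i, (d i - 1) = (m + 1) * K ∧
      ∀ g, g * D ∈ Ideal.span (Set.range fun i => (X i : MvPolynomial (Fin (m + 1)) F) ^ (K + 1)) ↔
        g ∈ Ideal.span (Set.range f) := by
  obtain ⟨K₀, hK₀⟩ := exists_X_pow_mem hzero
  set K := K₀ + ∑ i, d i with hK
  have hdK : ∀ j, d j ≤ K + 1 := fun j => by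
    have := Finset.single_le_sum (f := d) (fun _ _ => Nat.zero_le _) (Finset.mem_univ j)
    omega
  have hXI := hK₀ (K + 1) (by omega)
  choose A hAhom hA using fun i => exists_homogeneous_coeffs hhom hdK (isHomogeneous_X_pow i _) (hXI i)
  set y : Fin (m + 1) → MvPolynomial (Fin (m + 1)) F := fun i => X i ^ (K + 1) with hy
  have hAf : (Matrix.of A).mulVec f = y := _root_.funext hA
  refine ⟨K, ∑ j, (K + 1 - d j), (Matrix.of A).det, ?_, ?_, fun g => ⟨fun hg => ?_, fun hg => ?_⟩⟩
  · rw [Matrix.det_apply]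
    refine IsHomogeneous.sum _ _ _ fun τ _ => ?_
    rw [Units.smul_def, zsmul_eq_mul]
    have : (((Equiv.Perm.sign τ : ℤˣ) : ℤ) : MvPolynomial (Fin (m + 1)) F).IsHomogeneous 0 := by
      rw [← map_intCast (C : F →+* MvPolynomial (Fin (m + 1)) F)]
      exact isHomogeneous_C _ _
    rw [← zero_add (∑ j, _)]
    exact this.mul (IsHomogeneous.prod _ _ _ fun j _ => hAhom _ j)
  · rw [← Finset.sum_add_distrib, Finset.sum_congr rfl (g := fun _ => K)]
    · simp
    · intro j _
      have := hd j
      have := hdK j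
      omega
  · refine mem_of_forall_mul_mem (K := K) (Ideal.span_le.2 ?_) g fun h hh => ?_
    · rintro _ ⟨i, rfl⟩
      exact hXI i
    · obtain ⟨e, he⟩ := exists_sub_mul_det_mem_span y f (Matrix.of A) hAf
        (fun n c hc => exists_koszulDiff_eq y _ (by simp [hy, List.mem_ofFn]) _
          (isWeaklyRegular_X_pow F (m + 1) (K + 1)) n (by simp) c hc) h
        (fun j => hh _ (Ideal.subset_span ⟨j, rfl⟩))
      have : h * g = (h - e * (Matrix.of A).det) * g + e * (g * (Matrix.of A).det) := by ring
      rw [this]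
      exact Ideal.add_mem _ (Ideal.mul_mem_right _ _ he) (Ideal.mul_mem_left _ _ hg)
  · have hle : Ideal.span (Set.range f) ≤
        Submodule.comap (LinearMap.mulRight (MvPolynomial (Fin (m + 1)) F)
          (Matrix.of A).det) (Ideal.span (Set.range y)) := by
      refine Ideal.span_le.2 ?_
      rintro _ ⟨j, rfl⟩
      change f j * (Matrix.of A).det ∈ Ideal.span (Set.range y)
      have h1 : (Matrix.of A).adjugate.mulVec y = (Matrix.of A).det • f := by
        rw [← hAf, Matrix.mulVec_mulVec, Matrix.adjugate_mul, Matrix.smul_mulVec, Matrix.one_mulVec]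
      have h2 := congrFun h1 j
      rw [Pi.smul_apply, smul_eq_mul, mul_comm] at h2
      rw [← h2]
      change ∑ i, (Matrix.of A).adjugate j i * y i ∈ Ideal.span (Set.range y)
      exact Ideal.sum_mem _ fun i _ =>
        Ideal.mul_mem_left _ _ (Ideal.subset_span (Set.mem_range_self i))
    exact hle hg

end MvPolynomial

end Macaulay

section Duality

namespace MvPolynomial

variable {F : Type*} [Field F] [IsAlgClosed F] {m : ℕ} {d : Fin (m + 1) → ℕ}
  {f : Fin (m + 1) → MvPolynomial (Fin (m + 1)) F}

lemma exists_mul_monomial_notMem (hd : ∀ i, 1 ≤ d i) (hhom : ∀ i, (f i).IsHomogeneous (d i))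
    (hzero : ∀ x : Fin (m + 1) → F, (∀ i, eval x (f i) = 0) → x = 0) {i : ℕ}
    {p : MvPolynomial (Fin (m + 1)) F} (hp : p.IsHomogeneous i)
    (hpI : p ∉ Ideal.span (Set.range f)) :
    i ≤ ∑ j, (d j - 1) ∧ ∃ q : MvPolynomial (Fin (m + 1)) F,
      q.IsHomogeneous (∑ j, (d j - 1) - i) ∧ p * q ∉ Ideal.span (Set.range f) := by
  obtain ⟨K, δ, D, hD, hδ, hlink⟩ := exists_linkage hd hhom hzero
  obtain ⟨u, hu⟩ := exists_coeff_socleExponent_ne_zero (mt (hlink p).1 hpI)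
  have hdeg := ((hp.mul hD).mul (isHomogeneous_monomial (1 : F) rfl)).degree_eq hu
  rw [degree_socleExponent, Fintype.card_fin] at hdeg
  refine ⟨by omega, monomial u 1, isHomogeneous_monomial _ (by omega), fun h => hu ?_⟩
  apply coeff_socleExponent_eq_zero
  rw [mul_right_comm]
  exact (hlink _).2 h

omit [IsAlgClosed F] in
lemma one_notMem_span_range (hd : ∀ i, 1 ≤ d i) (hhom : ∀ i, (f i).IsHomogeneous (d i)) :
    1 ∉ Ideal.span (Set.range f) := by
  have hle : Ideal.span (Set.range f) ≤ RingHom.ker (constantCoeff (σ := Fin (m + 1)) (R := F)) := by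
    refine Ideal.span_le.2 ?_
    rintro _ ⟨i, rfl⟩
    refine (hhom i).coeff_eq_zero ?_
    have := hd i
    simp
    omega
  intro h
  simpa using hle h

lemma exists_sub_smul_mem_span_range (hd : ∀ i, 1 ≤ d i) (hhom : ∀ i, (f i).IsHomogeneous (d i))
    (hzero : ∀ x : Fin (m + 1) → F, (∀ i, eval x (f i) = 0) → x = 0)
    {p q : MvPolynomial (Fin (m + 1)) F} (hp : p.IsHomogeneous (∑ j, (d j - 1)))
    (hq : q.IsHomogeneous (∑ j, (d j - 1))) (hpI : p ∉ Ideal.span (Set.range f)) :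
    ∃ c : F, c • p - q ∈ Ideal.span (Set.range f) := by
  obtain ⟨K, δ, D, hD, hδ, hlink⟩ := exists_linkage hd hhom hzero
  have key : ∀ g : MvPolynomial (Fin (m + 1)) F, g.IsHomogeneous (∑ j, (d j - 1)) →
      coeff (socleExponent (Fin (m + 1)) K) (g * D) = 0 → g ∈ Ideal.span (Set.range f) := by
    intro g hg h0
    refine (hlink g).1 (by_contra fun h => ?_)
    obtain ⟨u, hu⟩ := exists_coeff_socleExponent_ne_zero h
    have hdeg := ((hg.mul hD).mul (isHomogeneous_monomial (1 : F) rfl)).degree_eq hu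
    rw [degree_socleExponent, Fintype.card_fin] at hdeg
    obtain rfl : u = 0 := (Finsupp.degree_eq_zero_iff u).1 (by omega)
    simp [h0] at hu
  have hp0 := mt (key p hp) hpI
  refine ⟨coeff (socleExponent (Fin (m + 1)) K) (q * D) /
    coeff (socleExponent (Fin (m + 1)) K) (p * D), key _ ?_ ?_⟩
  · exact (homogeneousSubmodule _ F _).sub_mem ((homogeneousSubmodule _ F _).smul_mem _ hp) hq
  · rw [sub_mul, smul_mul_assoc, coeff_sub, coeff_smul, smul_eq_mul, div_mul_cancel₀ _ hp0, sub_self]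

end MvPolynomial

end Duality

lemma mem_gradedPiece {N : ℕ} {I : Ideal (MvPolynomial (Fin N) ℂ)} {e : ℕ}
    {a : MvPolynomial (Fin N) ℂ ⧸ I} :
    a ∈ gradedPiece I e ↔
      ∃ p : MvPolynomial (Fin N) ℂ, p.IsHomogeneous e ∧ Ideal.Quotient.mk I p = a :=
  Iff.rfl

/-- Macaulay's theorem. -/
theorem macaulay (n : ℕ) (d : Fin (n + 2) → ℕ) (hd : ∀ i, 1 ≤ d i)
    (f : Fin (n + 2) → MvPolynomial (Fin (n + 2)) ℂ)
    (hhom : ∀ i, (f i).IsHomogeneous (d i))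
    (hzero : ∀ x : Fin (n + 2) → ℂ, (∀ i, MvPolynomial.eval x (f i) = 0) → x = 0)
    (I : Ideal (MvPolynomial (Fin (n + 2)) ℂ)) (hI : I = Ideal.span (Set.range f))
    (σ : ℕ) (hσ : σ = ∑ i, (d i - 1)) :
    Module.finrank ℂ (gradedPiece I σ) = 1 ∧
    (∀ i ≤ σ,
      (∀ a ∈ gradedPiece I i, a ≠ 0 → ∃ b ∈ gradedPiece I (σ - i), a * b ≠ 0) ∧
      (∀ b ∈ gradedPiece I (σ - i), b ≠ 0 → ∃ a ∈ gradedPiece I i, a * b ≠ 0)) ∧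
    (∀ e, σ < e → gradedPiece I e = ⊥) := by
  subst hI hσ
  have hpair : ∀ i, ∀ a ∈ gradedPiece (Ideal.span (Set.range f)) i, a ≠ 0 →
      i ≤ ∑ j, (d j - 1) ∧
        ∃ b ∈ gradedPiece (Ideal.span (Set.range f)) (∑ j, (d j - 1) - i), a * b ≠ 0 := by
    rintro i _ ⟨p, hp, rfl⟩ ha
    obtain ⟨hi, q, hq, hpq⟩ := exists_mul_monomial_notMem hd hhom hzero hp
      fun h => ha (Ideal.Quotient.eq_zero_iff_mem.2 h)
    exact ⟨hi, _, mem_gradedPiece.2 ⟨q, hq, rfl⟩,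
      fun h => hpq (Ideal.Quotient.eq_zero_iff_mem.1 ((map_mul _ _ _).trans h))⟩
  refine ⟨?_, fun i hi => ⟨fun a ha h => (hpair i a ha h).2, fun b hb h => ?_⟩, fun e he => ?_⟩
  · obtain ⟨-, p, hp, hpI⟩ := exists_mul_monomial_notMem hd hhom hzero
      (isHomogeneous_one (Fin (n + 2)) ℂ) (one_notMem_span_range hd hhom)
    rw [one_mul] at hpI
    rw [Nat.sub_zero] at hp
    refine (finrank_eq_one_iff_of_nonzero' ⟨_, mem_gradedPiece.2 ⟨p, hp, rfl⟩⟩ ?_).2 ?_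
    · exact fun h => hpI (Ideal.Quotient.eq_zero_iff_mem.1 (congrArg Subtype.val h))
    · rintro ⟨_, q, hq, rfl⟩
      obtain ⟨c, hc⟩ := exists_sub_smul_mem_span_range hd hhom hzero hp hq hpI
      exact ⟨c, Subtype.ext (Ideal.Quotient.eq.2 hc)⟩
  · obtain ⟨-, a, ha, hab⟩ := hpair _ b hb h
    rw [Nat.sub_sub_self hi] at ha
    exact ⟨a, ha, by rwa [mul_comm]⟩
  · refine (Submodule.eq_bot_iff _).2 fun a ha => by_contra fun h => ?_
    exact absurd (hpair e a ha h).1 (not_le.2 he)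
end

section
/- Let n ≥ 0 and let F ∈ ℂ[x_0, …, x_{n+1}] be homogeneous of degree d ≥ 2 such that the partial derivatives ∂F/∂x_0, …, ∂F/∂x_{n+1} have no common zero in ℂ^{n+2} other than the origin (i.e. the hypersurface {F = 0} ⊆ ℙ^{n+1} is smooth). Let J^F := ⟨∂F/∂x_0, …, ∂F/∂x_{n+1}⟩ and R^F := ℂ[x_0,…,x_{n+1}]/J^F. Then det(Hess(F)) ∉ J^F, and the graded piece R^F_{(d−2)(n+2)} is the one-dimensional ℂ-vector space spanned by the class of det(Hess(F)); equivalently, for every homogeneous P of degree (d−2)(n+2) there is a unique c ∈ ℂ with P − c·det(Hess(F)) ∈ J^F. -/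
open MvPolynomial

/-- The Hessian matrix `(∂²F/∂x_i∂x_j)` of a polynomial. -/
noncomputable def hessMatrix {N : ℕ} (F : MvPolynomial (Fin N) ℂ) :
    Matrix (Fin N) (Fin N) (MvPolynomial (Fin N) ℂ) :=
  fun i j => MvPolynomial.pderiv i (MvPolynomial.pderiv j F)

section Koszul

open ExteriorAlgebra

variable {R M : Type*} [CommRing R] [AddCommGroup M] [Module R M]

lemma Module.Basis.mem_smul_top_iff_repr {ι : Type*} (b : Module.Basis ι R M) (I : Ideal R)
    (y : M) :
    y ∈ (I • ⊤ : Submodule R M) ↔ ∀ i, b.repr y i ∈ I := by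
  constructor
  · intro hy i
    induction hy using Submodule.smul_induction_on' with
    | smul r hr n _ => simpa using I.mul_mem_right _ hr
    | add x _ y _ hx hy => simpa using I.add_mem hx hy
  · intro h
    rw [← b.linearCombination_repr y, Finsupp.linearCombination_apply]
    exact Submodule.sum_mem _ fun i _ => Submodule.smul_mem_smul (h i) trivial

/-- The Koszul differential attached to a linear form, as contraction on the exterior algebra. -/
noncomputable def koszulDifferential (d : Module.Dual R M) :
    ExteriorAlgebra R M →ₗ[R] ExteriorAlgebra R M :=
  CliffordAlgebra.contractLeft (Q := (0 : QuadraticForm R M)) d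

lemma koszulDifferential_ι_mul (d : Module.Dual R M) (v : M) (x : ExteriorAlgebra R M) :
    koszulDifferential d (ι R v * x) = d v • x - ι R v * koszulDifferential d x :=
  CliffordAlgebra.contractLeft_ι_mul _ _ _

lemma koszulDifferential_koszulDifferential (d : Module.Dual R M) (x : ExteriorAlgebra R M) :
    koszulDifferential d (koszulDifferential d x) = 0 :=
  CliffordAlgebra.contractLeft_contractLeft _ _

lemma koszulDifferential_one (d : Module.Dual R M) :
    koszulDifferential d (1 : ExteriorAlgebra R M) = 0 :=
  CliffordAlgebra.contractLeft_one (Q := (0 : QuadraticForm R M)) d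

lemma algebraMapInv_koszulDifferential_mem (d : Module.Dual R M) (w : ExteriorAlgebra R M) :
    algebraMapInv (koszulDifferential d w) ∈ LinearMap.range d := by
  induction w using CliffordAlgebra.left_induction with
  | algebraMap r =>
    rw [koszulDifferential, CliffordAlgebra.contractLeft_algebraMap, map_zero]
    exact zero_mem _
  | add x y hx hy => rw [map_add, map_add]; exact add_mem hx hy
  | ι_mul x m hx =>
    have h := koszulDifferential_ι_mul d m x
    have h0 : algebraMapInv (ι R m) = 0 := by simp [algebraMapInv]
    rw [show CliffordAlgebra.ι (0 : QuadraticForm R M) m = ι R m from rfl, h, map_sub, map_mul, h0,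
      zero_mul, sub_zero, map_smul, smul_eq_mul, mul_comm]
    exact ⟨algebraMapInv x • m, by simp⟩

lemma mul_mem_ideal_smul_top {A : Type*} [Ring A] [Algebra R A] (I : Ideal R) (a : A) {y : A}
    (hy : y ∈ (I • ⊤ : Submodule R A)) : a * y ∈ (I • ⊤ : Submodule R A) := by
  induction hy using Submodule.smul_induction_on' with
  | smul r hr n _ => rw [mul_smul_comm]; exact Submodule.smul_mem_smul hr trivial
  | add x _ y _ hx hy => rw [mul_add]; exact add_mem hx hy

lemma map_mem_ideal_smul_top {M' : Type*} [AddCommGroup M'] [Module R M'] (I : Ideal R)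
    (f : M →ₗ[R] M') {y : M} (hy : y ∈ (I • ⊤ : Submodule R M)) :
    f y ∈ (I • ⊤ : Submodule R M') := by
  induction hy using Submodule.smul_induction_on' with
  | smul r hr n _ => rw [map_smul]; exact Submodule.smul_mem_smul hr trivial
  | add x _ y _ hx hy => rw [map_add]; exact add_mem hx hy

lemma koszulDifferential_prod_mem (d : Module.Dual R M) (L : List M) :
    koszulDifferential d (L.map (ι R)).prod ∈
      (Ideal.span {r | ∃ v ∈ L, d v = r} • ⊤ : Submodule R (ExteriorAlgebra R M)) := by
  induction L with
  | nil => rw [List.map_nil, List.prod_nil, koszulDifferential_one]; exact zero_mem _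
  | cons v t ih =>
    rw [List.map_cons, List.prod_cons, koszulDifferential_ι_mul]
    refine sub_mem (Submodule.smul_mem_smul (Ideal.subset_span ⟨v, by simp⟩) trivial)
      (mul_mem_ideal_smul_top _ _ (Submodule.smul_mono_left (Ideal.span_mono ?_) ih))
    rintro _ ⟨w, hw, rfl⟩
    exact ⟨w, List.mem_cons_of_mem _ hw, rfl⟩

/-- Wedging with `v` is injective on Koszul homology modulo `d t`, when `d v` is regular
modulo `d t`; iterating, a multiple of `1` which dies after wedging with all of `L` was already a
boundary. -/
lemma smul_one_mem_range_koszulDifferential {κ : Type*}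
    (b : Module.Basis κ R (ExteriorAlgebra R M)) (d : Module.Dual R M)
    (L : List M)
    (hreg : ∀ v t, (v :: t) <:+ L → ∀ a : R, d v * a ∈ Ideal.span {r | ∃ v ∈ t, d v = r} →
      a ∈ Ideal.span {r | ∃ v ∈ t, d v = r})
    (P : R)
    (hP : P • (L.map (ι R)).prod ∈ LinearMap.range (koszulDifferential d) ⊔
      (Ideal.span {r | ∃ v ∈ L, d v = r} • ⊤ : Submodule R (ExteriorAlgebra R M))) :
    P • (1 : ExteriorAlgebra R M) ∈ LinearMap.range (koszulDifferential d) := by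
  induction L with
  | nil => simpa using hP
  | cons v t ih =>
    refine ih (fun w s h => hreg w s (h.trans (List.suffix_cons v t))) ?_
    set I := Ideal.span {r | ∃ v ∈ t, d v = r} with hI
    have hsplit : Ideal.span {r | ∃ w ∈ v :: t, d w = r} = Ideal.span {d v} ⊔ I := by
      rw [hI, ← Ideal.span_union]
      congr 1
      ext r
      simp [eq_comm]
    rw [hsplit, Submodule.sup_smul] at hP
    obtain ⟨_, ⟨w, rfl⟩, _, hq, hP⟩ := Submodule.mem_sup.1 hP
    obtain ⟨_, hy, u, hu, rfl⟩ := Submodule.mem_sup.1 hq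
    rw [Submodule.ideal_span_singleton_smul] at hy
    obtain ⟨y, -, rfl⟩ := (Submodule.mem_smul_pointwise_iff_exists _ _ _).1 hy
    set z := (t.map (ι R)).prod with hz
    have key := congrArg (koszulDifferential d) hP
    rw [List.map_cons, List.prod_cons, ← hz, map_add, koszulDifferential_koszulDifferential,
      map_add, map_smul, map_smul, koszulDifferential_ι_mul, zero_add] at key
    have hmem : d v • (P • z - koszulDifferential d y) ∈
        (I • ⊤ : Submodule R (ExteriorAlgebra R M)) := by
      have : d v • (P • z - koszulDifferential d y) =
          P • (ι R v * koszulDifferential d z) + koszulDifferential d u := by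
        rw [smul_sub] at key
        rw [smul_sub, smul_comm, ← eq_sub_iff_add_eq.1 key]
        abel
      rw [this]
      exact add_mem (Submodule.smul_mem _ _
        (mul_mem_ideal_smul_top _ _ (koszulDifferential_prod_mem d t)))
        (map_mem_ideal_smul_top _ _ hu)
    have hmem' : P • z - koszulDifferential d y ∈
        (I • ⊤ : Submodule R (ExteriorAlgebra R M)) := by
      rw [b.mem_smul_top_iff_repr] at hmem ⊢
      intro i
      refine hreg v t List.suffix_rfl _ ?_
      simpa using hmem i
    exact Submodule.mem_sup.2 ⟨_, ⟨y, rfl⟩, _, hmem', by abel⟩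

/-- If `B f = g` with `g` a (reversed) regular sequence, then multiplication by `det B` is
injective from `R / (f)` to `R / (g)`. -/
theorem mem_span_of_mul_det_mem_span {n : ℕ} (B : Matrix (Fin n) (Fin n) R) (f g : Fin n → R)
    (hB : B.mulVec f = g)
    (hreg : ∀ k a, g k * a ∈ Ideal.span (g '' Set.Ioi k) → a ∈ Ideal.span (g '' Set.Ioi k))
    (P : R) (hP : P * B.det ∈ Ideal.span (Set.range g)) : P ∈ Ideal.span (Set.range f) := by
  let d : Module.Dual R (Fin n → R) := Fintype.linearCombination R f
  have hd : ∀ i, d (B i) = g i := fun i => by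
    rw [← hB]; simp [d, Fintype.linearCombination_apply, Matrix.mulVec, dotProduct]
  let b := (Pi.basisFun R (Fin n)).ExteriorAlgebra
  have hmem : P • (1 : ExteriorAlgebra R (Fin n → R)) ∈ LinearMap.range (koszulDifferential d) := by
    refine smul_one_mem_range_koszulDifferential b d (List.ofFn fun i => B i) ?_ P ?_
    · intro v t hvt a ha
      obtain ⟨s, hs⟩ := hvt
      have hlen : s.length < n := by
        have := congrArg List.length hs
        simp at this
        omega
      have hget : ∀ j (hj : j < n), (s ++ v :: t)[j]? = some (B ⟨j, hj⟩) := by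
        intro j hj
        rw [hs]
        simp [hj]
      have hv : v = B ⟨s.length, hlen⟩ := by simpa using hget _ hlen
      have ht : {r | ∃ v ∈ t, d v = r} = g '' Set.Ioi ⟨s.length, hlen⟩ := by
        ext r
        constructor
        · rintro ⟨w, hw, rfl⟩
          obtain ⟨j, hj, rfl⟩ := List.getElem_of_mem hw
          have hjn : s.length + (j + 1) < n := by
            have := congrArg List.length hs
            simp at this
            omega
          refine ⟨⟨s.length + (j + 1), hjn⟩, by simp [Fin.lt_def], ?_⟩
          rw [← hd]
          have := hget _ hjn
          simp [hj] at this
          rw [this]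
        · rintro ⟨⟨k, hk⟩, hlt, rfl⟩
          have hlt : s.length < k := hlt
          obtain ⟨j, rfl⟩ : ∃ j, k = s.length + (j + 1) := ⟨k - s.length - 1, by omega⟩
          refine ⟨B ⟨_, hk⟩, ?_, hd _⟩
          have := hget _ hk
          rw [List.getElem?_append_right (by omega), Nat.add_sub_cancel_left,
            List.getElem?_cons_succ] at this
          exact List.mem_of_getElem? this
      rw [ht] at ha ⊢
      rw [hv, hd] at ha
      exact hreg _ _ ha
    · refine Submodule.mem_sup_right ((b.mem_smul_top_iff_repr _ _).2 fun i => ?_)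
      have hset : {r | ∃ v ∈ List.ofFn (fun i => B i), d v = r} = Set.range g := by
        ext r
        simp [List.mem_ofFn, hd]
      have h := congrArg (fun F => F (fun i => B i)) (AlternatingMap.eq_smul_basis_det
        (Pi.basisFun R (Fin n)) ((b.coord i).compAlternatingMap (ιMulti R n)))
      simp only [LinearMap.compAlternatingMap_apply, AlternatingMap.smul_apply,
        Pi.basisFun_det_apply] at h
      rw [hset, List.map_ofFn, map_smul, Finsupp.smul_apply, smul_eq_mul]
      change P * b.coord i (ιMulti R n fun i => B i) ∈ _
      rw [h, smul_eq_mul, mul_left_comm]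
      exact Ideal.mul_mem_left _ _ hP
  obtain ⟨w, hw⟩ := hmem
  have h := algebraMapInv_koszulDifferential_mem d w
  rw [hw] at h
  have hr : LinearMap.range d = Ideal.span (Set.range f) := Fintype.range_linearCombination R f
  rw [hr] at h
  simpa using h

end Koszul

namespace MvPolynomial

section Monomial

variable {σ R : Type*} [CommRing R]

lemma mem_span_image_X_pow_iff (T : Set σ) (M : ℕ) (p : MvPolynomial σ R) :
    p ∈ Ideal.span ((fun i => (X i : MvPolynomial σ R) ^ M) '' T) ↔
      ∀ m ∈ p.support, ∃ i ∈ T, M ≤ m i := by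
  have h := mem_ideal_span_monomial_image (x := p) (s := (fun i => Finsupp.single i M) '' T)
  rw [Set.image_image] at h
  simp_rw [← X_pow_eq_monomial] at h
  rw [h]
  simp

lemma mem_span_range_X_pow_iff (M : ℕ) (p : MvPolynomial σ R) :
    p ∈ Ideal.span (Set.range fun i => (X i : MvPolynomial σ R) ^ M) ↔
      ∀ m ∈ p.support, ∃ i, M ≤ m i := by
  rw [← Set.image_univ, mem_span_image_X_pow_iff]
  simp

lemma mem_span_image_X_pow_of_X_pow_mul_mem {T : Set σ} {M : ℕ} {k : σ} (hk : k ∉ T)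
    {p : MvPolynomial σ R}
    (hp : X k ^ M * p ∈ Ideal.span ((fun i => (X i : MvPolynomial σ R) ^ M) '' T)) :
    p ∈ Ideal.span ((fun i => (X i : MvPolynomial σ R) ^ M) '' T) := by
  rw [mem_span_image_X_pow_iff] at hp ⊢
  intro m hm
  obtain ⟨i, hi, hle⟩ := hp (Finsupp.single k M + m) (by
    rw [mem_support_iff, X_pow_eq_monomial, coeff_monomial_mul, one_mul]
    exact mem_support_iff.1 hm)
  refine ⟨i, hi, ?_⟩
  have hne : k ≠ i := fun h => hk (h ▸ hi)
  simpa [Finsupp.single_eq_of_ne hne.symm] using hle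

lemma IsHomogeneous.sub_monomial_mem_span_X_pow [Fintype σ] {M : ℕ}
    {p : MvPolynomial σ R} (hp : p.IsHomogeneous (Fintype.card σ * (M - 1))) :
    p - monomial (Finsupp.equivFunOnFinite.symm fun _ => M - 1)
        (coeff (Finsupp.equivFunOnFinite.symm fun _ => M - 1) p) ∈
      Ideal.span (Set.range fun i => (X i : MvPolynomial σ R) ^ M) := by
  classical
  set m₀ : σ →₀ ℕ := Finsupp.equivFunOnFinite.symm fun _ => M - 1 with hm₀
  rw [mem_span_range_X_pow_iff]
  intro m hm
  by_contra! hlt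
  rw [mem_support_iff, coeff_sub, coeff_monomial] at hm
  have hne : m₀ ≠ m := by rintro rfl; simp at hm
  rw [if_neg hne, sub_zero] at hm
  have hdeg : ∑ i, m i = Fintype.card σ * (M - 1) := by
    rw [← Finsupp.degree_eq_sum]
    by_contra h
    exact hm (hp.coeff_eq_zero h)
  refine hne (Finsupp.ext fun i => ?_)
  have h := (Finset.sum_eq_sum_iff_of_le (s := Finset.univ) (f := m) (g := fun _ => M - 1)
    fun i _ => Nat.le_sub_one_of_lt (hlt i)).1 (by simp [hdeg])
  exact (h i (Finset.mem_univ i)).symm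

lemma homogeneousComponent_mul_of_isHomogeneous_s7 {e k : ℕ} (a : MvPolynomial σ R)
    {f : MvPolynomial σ R} (hf : f.IsHomogeneous e) (hk : e ≤ k) :
    homogeneousComponent k (a * f) = homogeneousComponent (k - e) a * f := by
  let _ : GradedAlgebra (homogeneousSubmodule σ R) := gradedAlgebra
  have h := DirectSum.coe_decompose_mul_of_right_mem_of_le (homogeneousSubmodule σ R)
    (a := a) (b_mem := (mem_homogeneousSubmodule e f).2 hf) hk
  rw [← decomposition.decompose'_apply, ← decomposition.decompose'_apply]
  exact h

lemma isHomogeneous_det {n : Type*} [DecidableEq n] [Fintype n] {e : ℕ}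
    {A : Matrix n n (MvPolynomial σ R)} (hA : ∀ i j, (A i j).IsHomogeneous e) :
    A.det.IsHomogeneous (Fintype.card n * e) := by
  rw [Matrix.det_apply]
  refine IsHomogeneous.sum _ _ _ fun τ _ => ?_
  have h : (∏ i, A (τ i) i).IsHomogeneous (Fintype.card n * e) := by
    simpa using IsHomogeneous.prod Finset.univ (fun i => A (τ i) i) (fun _ => e)
      fun i _ => hA _ _
  rcases Int.units_eq_one_or (Equiv.Perm.sign τ) with hs | hs
  · simpa [hs] using h
  · simpa [hs] using h.neg

end Monomial

lemma exists_homogeneous_mulVec_eq_X_pow {K σ : Type*} [Field K] [IsAlgClosed K] [Fintype σ]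
    {e : ℕ} {f : σ → MvPolynomial σ K} (hf : ∀ i, (f i).IsHomogeneous e)
    (hzero : ∀ x : σ → K, (∀ i, eval x (f i) = 0) → x = 0) :
    ∃ M, e ≤ M ∧ ∃ B : Matrix σ σ (MvPolynomial σ K),
      (∀ i j, (B i j).IsHomogeneous (M - e)) ∧ B.mulVec f = fun i => X i ^ M := by
  have hrad : ∀ j, ∃ k, (X j : MvPolynomial σ K) ^ k ∈ Ideal.span (Set.range f) := fun j => by
    change X j ∈ (Ideal.span (Set.range f)).radical
    rw [← vanishingIdeal_zeroLocus_eq_radical (K := K), mem_vanishingIdeal_iff]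
    intro x hx
    have : x = 0 := hzero x fun i => by
      simpa [aeval_eq_eval] using hx (f i) (Ideal.subset_span ⟨i, rfl⟩)
    simp [this]
  choose k hk using hrad
  have hmem : ∀ j, (X j : MvPolynomial σ K) ^ (Finset.univ.sup k + e) ∈
      Ideal.span (Set.range f) := fun j =>
    Ideal.pow_mem_of_pow_mem _ (hk j) ((Finset.le_sup (Finset.mem_univ j)).trans le_self_add)
  choose B hB using fun j => (Submodule.mem_span_range_iff_exists_fun _).1 (hmem j)
  refine ⟨Finset.univ.sup k + e, Nat.le_add_left e _, fun i j => homogeneousComponent _ (B i j),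
    fun i j => homogeneousComponent_isHomogeneous _ _, ?_⟩
  funext i
  have h := congrArg (homogeneousComponent (Finset.univ.sup k + e)) (hB i)
  rw [map_sum, homogeneousComponent_eq_self (isHomogeneous_X_pow (R := K) i _)] at h
  rw [← h]
  refine Finset.sum_congr rfl fun j _ => ?_
  rw [smul_eq_mul, homogeneousComponent_mul_of_isHomogeneous_s7 _ (hf j) (Nat.le_add_left e _)]

lemma det_mul_mem_span_mulVec {R m : Type*} [CommRing R] [Fintype m] [DecidableEq m]
    (B : Matrix m m R) (f : m → R) {p : R} (hp : p ∈ Ideal.span (Set.range f)) :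
    B.det * p ∈ Ideal.span (Set.range (B.mulVec f)) := by
  obtain ⟨c, rfl⟩ := (Submodule.mem_span_range_iff_exists_fun _).1 hp
  rw [Finset.mul_sum]
  refine Ideal.sum_mem _ fun i _ => ?_
  have h : B.det * f i = ∑ j, B.adjugate i j * B.mulVec f j := by
    have := congrFun (Matrix.mulVec_mulVec f B.adjugate B) i
    rw [Matrix.adjugate_mul, Matrix.smul_mulVec, Matrix.one_mulVec] at this
    exact this.symm
  rw [smul_eq_mul, mul_left_comm, h]
  exact Ideal.mul_mem_left _ _ (Ideal.sum_mem _ fun j _ =>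
    Ideal.mul_mem_left _ _ (Ideal.subset_span ⟨j, rfl⟩))

/-- For a homogeneous system of parameters `f = A x`, the determinant of `A` spans the socle
of `K[x] / (f)`. -/
theorem det_notMem_and_exists_sub_mem {K : Type*} [Field K] [IsAlgClosed K] {n e : ℕ} (he : 1 ≤ e)
    {f : Fin n → MvPolynomial (Fin n) K} (hf : ∀ i, (f i).IsHomogeneous e)
    (hzero : ∀ x : Fin n → K, (∀ i, eval x (f i) = 0) → x = 0)
    {A : Matrix (Fin n) (Fin n) (MvPolynomial (Fin n) K)}
    (hA : ∀ i j, (A i j).IsHomogeneous (e - 1)) (hAf : A.mulVec X = f) :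
    A.det ∉ Ideal.span (Set.range f) ∧
      ∀ P : MvPolynomial (Fin n) K, P.IsHomogeneous (n * (e - 1)) →
        ∃ c : K, P - C c * A.det ∈ Ideal.span (Set.range f) := by
  obtain ⟨M, heM, B, hB, hBf⟩ := exists_homogeneous_mulVec_eq_X_pow hf hzero
  have hreg : ∀ (k : Fin n) (a : MvPolynomial (Fin n) K),
      X k ^ M * a ∈ Ideal.span ((fun i => (X i : MvPolynomial (Fin n) K) ^ M) '' Set.Ioi k) →
      a ∈ Ideal.span ((fun i => (X i : MvPolynomial (Fin n) K) ^ M) '' Set.Ioi k) :=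
    fun k a ha => mem_span_image_X_pow_of_X_pow_mul_mem (by simp) ha
  have hBA : B.det * A.det ∉ Ideal.span (Set.range fun i => (X i : MvPolynomial (Fin n) K) ^ M) := by
    intro h
    have h1 := mem_span_of_mul_det_mem_span (B * A) X _
      (by rw [← Matrix.mulVec_mulVec, hAf, hBf]) hreg 1 (by rwa [one_mul, Matrix.det_mul])
    rw [← Set.image_univ, mem_ideal_span_X_image] at h1
    obtain ⟨i, -, hi⟩ := h1 0 (by simp)
    exact hi rfl
  refine ⟨fun h => hBA (hBf ▸ det_mul_mem_span_mulVec B f h), fun P hP => ?_⟩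
  have hdet {Q : MvPolynomial (Fin n) K} (hQ : Q.IsHomogeneous (n * (e - 1))) :
      (B.det * Q).IsHomogeneous (Fintype.card (Fin n) * (M - 1)) := by
    have hdeg : n * (M - 1) = n * (M - e) + n * (e - 1) := by
      rw [← mul_add]
      congr 1
      omega
    rw [Fintype.card_fin, hdeg]
    simpa using (isHomogeneous_det hB).mul hQ
  have hred (Q : MvPolynomial (Fin n) K) (hQ : Q.IsHomogeneous (n * (e - 1))) :=
    (hdet hQ).sub_monomial_mem_span_X_pow
  set m₀ : Fin n →₀ ℕ := Finsupp.equivFunOnFinite.symm fun _ => M - 1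
  have hPm := hred P hP
  have hAm := hred A.det (by simpa using isHomogeneous_det hA)
  have hc : coeff m₀ (B.det * A.det) ≠ 0 := fun h => hBA (by simpa [h] using hAm)
  refine ⟨coeff m₀ (B.det * P) / coeff m₀ (B.det * A.det),
    mem_span_of_mul_det_mem_span B f _ hBf hreg _ ?_⟩
  convert Ideal.sub_mem _ hPm (Ideal.mul_mem_left _
    (C (coeff m₀ (B.det * P) / coeff m₀ (B.det * A.det))) hAm) using 1
  rw [mul_sub (C _), C_mul_monomial, div_mul_cancel₀ _ hc]
  ring

end MvPolynomial

theorem det_hess_spans_top_piece_of_jacobian (n d : ℕ) (hd : 2 ≤ d)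
    (F : MvPolynomial (Fin (n + 2)) ℂ) (hF : F.IsHomogeneous d)
    (hsmooth : ∀ x : Fin (n + 2) → ℂ,
      (∀ i, MvPolynomial.eval x (MvPolynomial.pderiv i F) = 0) → x = 0)
    (JF : Ideal (MvPolynomial (Fin (n + 2)) ℂ))
    (hJF : JF = Ideal.span (Set.range fun i => MvPolynomial.pderiv i F)) :
    (hessMatrix F).det ∉ JF ∧
      gradedPiece JF ((d - 2) * (n + 2)) =
        Submodule.span ℂ {Ideal.Quotient.mk JF (hessMatrix F).det} ∧
      ∀ P : MvPolynomial (Fin (n + 2)) ℂ, P.IsHomogeneous ((d - 2) * (n + 2)) →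
        ∃! c : ℂ, P - C c * (hessMatrix F).det ∈ JF := by
  have hu : ((d - 1 : ℕ) : ℂ) ≠ 0 := Nat.cast_ne_zero.2 (by omega)
  have hhess (i j) : (hessMatrix F i j).IsHomogeneous (d - 2) := by
    simpa [hessMatrix, Nat.sub_sub] using (hF.pderiv (i := j)).pderiv (i := i)
  have hdetHom : (hessMatrix F).det.IsHomogeneous ((d - 2) * (n + 2)) := by
    simpa [mul_comm] using isHomogeneous_det hhess
  let f : Fin (n + 2) → MvPolynomial (Fin (n + 2)) ℂ :=
    fun i => C ((d - 1 : ℕ) : ℂ) * pderiv i F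
  have heuler : (hessMatrix F).transpose.mulVec X = f := funext fun i => by
    have h := (hF.pderiv (i := i)).sum_X_mul_pderiv
    simp only [Matrix.mulVec, dotProduct, Matrix.transpose_apply, hessMatrix, f]
    simp_rw [mul_comm _ (X _)]
    rw [h, nsmul_eq_mul, map_natCast]
  have hspan : JF = Ideal.span (Set.range f) := by
    rw [hJF]
    refine le_antisymm (Ideal.span_le.2 ?_) (Ideal.span_le.2 ?_)
    · rintro _ ⟨i, rfl⟩
      have : pderiv i F = C (((d - 1 : ℕ) : ℂ)⁻¹) * f i := by
        rw [← mul_assoc, ← C_mul, inv_mul_cancel₀ hu, C_1, one_mul]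
      change pderiv i F ∈ _
      rw [this]
      exact Ideal.mul_mem_left _ _ (Ideal.subset_span ⟨i, rfl⟩)
    · rintro _ ⟨i, rfl⟩
      exact Ideal.mul_mem_left _ _ (Ideal.subset_span ⟨i, rfl⟩)
  obtain ⟨hnot, hex⟩ := det_notMem_and_exists_sub_mem (e := d - 1) (f := f) (by omega)
    (fun i => (hF.pderiv (i := i)).C_mul _)
    (fun x hx => hsmooth x fun i => by
      have h := hx i
      rw [map_mul, eval_C] at h
      exact (mul_eq_zero.1 h).resolve_left hu)
    (fun i j => by simpa [Nat.sub_sub] using hhess j i) heuler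
  rw [Matrix.det_transpose, ← hspan] at hnot
  rw [Matrix.det_transpose, ← hspan, Nat.sub_sub, mul_comm] at hex
  refine ⟨hnot, le_antisymm ?_ ?_, fun P hP => ?_⟩
  · rintro _ ⟨P, hP, rfl⟩
    obtain ⟨c, hc⟩ := hex P hP
    refine Submodule.mem_span_singleton.2 ⟨c, ?_⟩
    rw [← Ideal.Quotient.eq] at hc
    change Ideal.Quotient.mk JF (c • (hessMatrix F).det) = Ideal.Quotient.mk JF P
    rw [hc, smul_eq_C_mul]
  · rw [Submodule.span_singleton_le_iff_mem]
    exact ⟨_, hdetHom, rfl⟩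
  · obtain ⟨c, hc⟩ := hex P hP
    refine ⟨c, hc, fun c' hc' => ?_⟩
    by_contra hne
    refine hnot ?_
    have h := JF.mul_mem_left (C (c' - c)⁻¹) (JF.sub_mem hc hc')
    have hinv : (C (c' - c)⁻¹ : MvPolynomial (Fin (n + 2)) ℂ) * (C c' - C c) = 1 := by
      rw [← C_sub, ← C_mul, inv_mul_cancel₀ (sub_ne_zero.2 hne), C_1]
    convert h using 1
    linear_combination -(hessMatrix F).det * hinv
end
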